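/- arXiv:1307.5411 — 2 statements merged into one kernel-verified Lean document; each statement's English description precedes it below -/
import Mathlib

section
/- Let n be a positive integer and let G be a connected graph cospectral with the friendship graph F_n. Then the minimum degree of G equals 2 (in particular G has no vertex of degree 1), and G has at least three vertices of degree 2. -/
open Polynomial

/-- The adjacency matrix of a simple graph, with entries in `R`. -/
noncomputable def adjMat (R : Type*) [Zero R] [One R] {V : Type*} [Fintype V]
    (G : SimpleGraph V) : Matrix V V R :=
  letI := Classical.decRel G.Adj
  G.adjMatrix R

/-- The friendship graph `F n`: `n` triangles glued at the common vertex `none`. -/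
def friendshipGraph (n : ℕ) : SimpleGraph (Option (Fin n × Bool)) :=
  SimpleGraph.fromRel (fun u v =>
    u = none ∨ ∃ i : Fin n, u = some (i, true) ∧ v = some (i, false))

/-- Two finite graphs are cospectral if their real adjacency matrices have the same
characteristic polynomial. -/
def Cospectral {V W : Type*} [Fintype V] [Fintype W] [DecidableEq V] [DecidableEq W]
    (G : SimpleGraph V) (H : SimpleGraph W) : Prop :=
  (adjMat ℝ G).charpoly = (adjMat ℝ H).charpoly

open Matrix

theorem eval_charpoly_sq {V : Type*} [Fintype V] [DecidableEq V] {R : Type*} [CommRing R]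
    (A : Matrix V V R) (s : R) :
    (A * A).charpoly.eval (s ^ 2) =
      (-1) ^ Fintype.card V * (A.charpoly.eval s * A.charpoly.eval (-s)) := by
  simp only [Matrix.eval_charpoly]
  rw [← Matrix.det_mul, ← Matrix.det_neg]
  congr 1
  have h : Matrix.scalar V (-s) = -Matrix.scalar V s := map_neg _ _
  have hc : Matrix.scalar V s * A = A * Matrix.scalar V s :=
    (Matrix.scalar_commute s (fun r => mul_comm _ _) A).eq
  rw [h, map_pow]
  linear_combination (norm := noncomm_ring) -hc

theorem charpoly_sq_eq_of_charpoly_eq {V W : Type*} [Fintype V] [Fintype W] [DecidableEq V]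
    [DecidableEq W] {A : Matrix V V ℝ} {B : Matrix W W ℝ} (h : A.charpoly = B.charpoly) :
    (A * A).charpoly = (B * B).charpoly := by
  have hcard : Fintype.card V = Fintype.card W := by
    rw [← A.charpoly_natDegree_eq_dim, h, B.charpoly_natDegree_eq_dim]
  refine Polynomial.eq_of_infinite_eval_eq _ _ ((Set.Ici_infinite (0 : ℝ)).mono ?_)
  intro x hx
  have := Real.sq_sqrt (Set.mem_Ici.mp hx)
  rw [Set.mem_ofPred_eq, ← this, eval_charpoly_sq, eval_charpoly_sq, h, hcard]

theorem posSemidef_sub_one_of_charpoly_eq {V W : Type*} [Fintype V] [Fintype W] [DecidableEq V]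
    [DecidableEq W] {M : Matrix V V ℝ} {N : Matrix W W ℝ} (h : M.charpoly = N.charpoly)
    (hM : M.IsHermitian) (hN : (N - 1).PosSemidef) : (M - 1).PosSemidef := by
  have hM1 : (M - 1).IsHermitian := hM.sub Matrix.isHermitian_one
  rw [hM1.posSemidef_iff_eigenvalues_nonneg]
  intro i
  by_contra! hneg
  simp only [Pi.zero_apply] at hneg
  set μ := hM1.eigenvalues i
  have hroot : (M - 1).charpoly.IsRoot μ :=
    Matrix.mem_spectrum_iff_isRoot_charpoly.mp (hM1.eigenvalues_mem_spectrum_real i)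
  have hdet : N.charpoly.eval (μ + 1) = 0 := by
    rw [← h, ← hroot.eq_zero, Matrix.eval_charpoly, Matrix.eval_charpoly, map_add, map_one]
    congr 1; abel
  have hpos : (Matrix.diagonal (fun _ : W => -μ)).PosDef :=
    Matrix.PosDef.diagonal (fun _ => by linarith)
  have := (Matrix.PosDef.posSemidef_add hN hpos).det_pos
  rw [Matrix.eval_charpoly, ← neg_neg (Matrix.scalar W (μ + 1) - N), Matrix.det_neg] at hdet
  have e : -(Matrix.scalar W (μ + 1) - N) = N - 1 + Matrix.diagonal (fun _ : W => -μ) := by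
    rw [map_add, map_one, ← Matrix.diagonal_neg, Matrix.scalar_apply]; abel
  rw [e] at hdet
  simp [this.ne'] at hdet

open Classical in
theorem adjMat_apply {V : Type*} [Fintype V] (R : Type*) [Zero R] [One R] (G : SimpleGraph V)
    (u v : V) : adjMat R G u v = if G.Adj u v then 1 else 0 := rfl

theorem adjMat_friendshipGraph (n : ℕ) : adjMat ℝ (friendshipGraph n) =
    Matrix.of fun u v => match u, v with
      | none, none => 0
      | none, some _ => 1
      | some _, none => 1
      | some (i, b), some (j, c) => if i = j ∧ b ≠ c then 1 else 0 := by
  ext u v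
  rcases u with _ | ⟨i, _ | _⟩ <;> rcases v with _ | ⟨j, _ | _⟩ <;>
    simp [adjMat_apply, friendshipGraph, eq_comm]

theorem adjMat_friendshipGraph_sq (n : ℕ) :
    adjMat ℝ (friendshipGraph n) * adjMat ℝ (friendshipGraph n) - 1 =
      Matrix.vecMulVec 1 1 + Matrix.diagonal (Pi.single none (2 * n - 2 : ℝ)) := by
  rw [adjMat_friendshipGraph]
  ext u v
  rcases u with _ | ⟨i, _ | _⟩ <;> rcases v with _ | ⟨j, _ | _⟩ <;>
    simp [-Finset.sum_boole, Matrix.mul_apply, Fintype.sum_option, Fintype.sum_prod_type,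
      Matrix.one_apply, Matrix.diagonal_apply, ite_and]
  all_goals ring

theorem posSemidef_adjMat_friendshipGraph_sq_sub_one {n : ℕ} (hn : 0 < n) :
    (adjMat ℝ (friendshipGraph n) * adjMat ℝ (friendshipGraph n) - 1).PosSemidef := by
  rw [adjMat_friendshipGraph_sq]
  refine Matrix.PosSemidef.add ?_ (Matrix.PosSemidef.diagonal ?_)
  · simpa using Matrix.posSemidef_vecMulVec_self_star (1 : Option (Fin n × Bool) → ℝ)
  · have : (1 : ℝ) ≤ n := by exact_mod_cast hn
    exact Pi.single_nonneg.mpr (by linarith)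

theorem trace_adjMat_friendshipGraph_sq (n : ℕ) :
    (adjMat ℝ (friendshipGraph n) * adjMat ℝ (friendshipGraph n)).trace = 6 * n := by
  rw [← sub_add_cancel (adjMat ℝ (friendshipGraph n) * adjMat ℝ (friendshipGraph n)) 1,
    adjMat_friendshipGraph_sq]
  rw [Matrix.trace_add, Matrix.trace_add, Matrix.trace_vecMulVec, Matrix.trace_diagonal,
    Matrix.trace_one]
  simp
  ring

theorem trace_eq_of_charpoly_eq {V W : Type*} [Fintype V] [Fintype W] [DecidableEq V]
    [DecidableEq W] {R : Type*} [Field R] {A : Matrix V V R} {B : Matrix W W R}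
    (h : A.charpoly = B.charpoly) : A.trace = B.trace := by
  rw [Matrix.trace_eq_neg_charpoly_nextCoeff, h, ← Matrix.trace_eq_neg_charpoly_nextCoeff]

/-- A pendant edge of a graph with `A² - 1` positive semidefinite is a connected component. -/
theorem card_le_two_of_degree_eq_one {V : Type*} [Fintype V] [DecidableEq V]
    {G : SimpleGraph V} [DecidableRel G.Adj] (hconn : G.Connected)
    (hpsd : (G.adjMatrix ℝ * G.adjMatrix ℝ - 1).PosSemidef) {v : V} (hv : G.degree v = 1) :
    Fintype.card V ≤ 2 := by
  have hzero : (G.adjMatrix ℝ * G.adjMatrix ℝ - 1) *ᵥ Pi.single v 1 = 0 := by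
    rw [← hpsd.dotProduct_mulVec_zero_iff]
    simp only [Matrix.mulVec_single_one, Pi.star_single, star_one, single_one_dotProduct,
      Matrix.col_apply, Matrix.sub_apply, SimpleGraph.adjMatrix_mul_self_apply_self, hv,
      Matrix.one_apply_eq, Nat.cast_one, sub_self]
  obtain ⟨w, hw, huniq⟩ := (G.degree_eq_one_iff_existsUnique_adj).mp hv
  have hback : ∀ u, G.Adj w u → u = v := by
    intro u hu
    by_contra hne
    have h := congrFun hzero u
    simp only [Matrix.mulVec_single_one, Matrix.col_apply, Matrix.sub_apply,
      Matrix.one_apply_ne hne, sub_zero, Pi.zero_apply, Matrix.mul_apply] at h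
    rw [Finset.sum_eq_zero_iff_of_nonneg
      (fun i _ => by simp only [SimpleGraph.adjMatrix_apply]; positivity)] at h
    simpa [hu.symm, hw.symm] using h w (Finset.mem_univ _)
  have hall : ∀ u, u ∈ ({v, w} : Finset V) := by
    intro u
    have hr := (SimpleGraph.reachable_iff_reflTransGen v u).mp (hconn.preconnected v u)
    induction hr with
    | refl => simp
    | tail _ hadj ih =>
      rcases Finset.mem_insert.mp ih with rfl | h
      · simp [huniq _ hadj]
      · rw [Finset.mem_singleton.mp h] at hadj
        simp [hback _ hadj]
  rw [← Finset.card_univ, ← Finset.eq_univ_iff_forall.mpr hall]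
  exact Finset.card_le_two

/-- if `G` is connected and cospectral with the friendship graph `F n`, then
the minimum degree of `G` equals 2 (every vertex has degree at least 2 and some vertex has
degree exactly 2), and `G` has at least three vertices of degree 2. -/
theorem connected_cospectral_min_degree_two
    {V : Type*} [Fintype V] [DecidableEq V]
    (n : ℕ) (hn : 0 < n) (G : SimpleGraph V) [DecidableRel G.Adj]
    (hG : Cospectral G (friendshipGraph n)) (hconn : G.Connected) :
    (∀ v : V, 2 ≤ G.degree v) ∧ (∃ v : V, G.degree v = 2) ∧
      3 ≤ (Finset.univ.filter fun v : V => G.degree v = 2).card := by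
  have hadj : adjMat ℝ G = G.adjMatrix ℝ := by
    unfold adjMat
    congr!
  have hcard : Fintype.card V = 2 * n + 1 := by
    rw [← (adjMat ℝ G).charpoly_natDegree_eq_dim, hG, Matrix.charpoly_natDegree_eq_dim]
    simp [mul_comm]
  have hsq := charpoly_sq_eq_of_charpoly_eq hG
  rw [hadj] at hsq
  have hherm : (G.adjMatrix ℝ * G.adjMatrix ℝ).IsHermitian := by
    simp [Matrix.IsHermitian]
  have hpsd := posSemidef_sub_one_of_charpoly_eq hsq hherm
    (posSemidef_adjMat_friendshipGraph_sq_sub_one hn)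
  have hsum : ∑ v, G.degree v = 6 * n := by
    have h := trace_eq_of_charpoly_eq hsq
    rw [trace_adjMat_friendshipGraph_sq] at h
    simp only [Matrix.trace, Matrix.diag_apply, SimpleGraph.adjMatrix_mul_self_apply_self] at h
    exact_mod_cast h
  have hdeg : ∀ v, 2 ≤ G.degree v := by
    intro v
    have hpos : 1 ≤ G.degree v := by
      have h := hpsd.diag_nonneg (i := v)
      simp only [Matrix.sub_apply, SimpleGraph.adjMatrix_mul_self_apply_self,
        Matrix.one_apply_eq, sub_nonneg] at h
      exact_mod_cast h
    have hne : G.degree v ≠ 1 := fun h => by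
      have := card_le_two_of_degree_eq_one hconn hpsd h
      lia
    lia
  have hthree : 3 ≤ (Finset.univ.filter fun v : V => G.degree v = 2).card := by
    have h : ∑ _v : V, 3 ≤ ∑ v, (G.degree v + if G.degree v = 2 then 1 else 0) :=
      Finset.sum_le_sum fun v _ => by have := hdeg v; split_ifs <;> lia
    rw [Finset.sum_add_distrib, hsum, ← Finset.card_filter] at h
    simp only [Finset.sum_const, Finset.card_univ, hcard, smul_eq_mul] at h
    lia
  obtain ⟨v, hv⟩ := Finset.card_pos.mp (Nat.lt_of_lt_of_le three_pos hthree)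
  exact ⟨hdeg, ⟨v, (Finset.mem_filter.mp hv).2⟩, hthree⟩
end

section
/- Let n be a positive integer and let G be a graph cospectral with the friendship graph F_n. If G contains two adjacent vertices that both have degree 2 in G, then G is isomorphic to F_n. -/
open Polynomial

open Matrix in
/-- Real symmetric matrices with the same characteristic polynomial are similar. -/
lemma Matrix.IsHermitian.exists_conj_of_charpoly_eq {V : Type*} [Fintype V] [DecidableEq V]
    {A B : Matrix V V ℝ} (hA : A.IsHermitian) (hB : B.IsHermitian)
    (h : A.charpoly = B.charpoly) : ∃ φ : Matrix V V ℝ ≃ₐ[ℝ] Matrix V V ℝ,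
      φ B = A ∧ ∀ C, (φ C).rank ≤ C.rank := by
  have hev := (hA.eigenvalues_eq_eigenvalues_iff hB).2 h
  let U := hA.eigenvectorUnitary * star hB.eigenvectorUnitary
  refine ⟨(Unitary.conjStarAlgAut ℝ _ U).toAlgEquiv, ?_, fun C => ?_⟩
  · change Unitary.conjStarAlgAut ℝ _ U B = A
    rw [Unitary.conjStarAlgAut_mul_apply, hB.conjStarAlgAut_star_eigenvectorUnitary, ← hev,
      ← hA.spectral_theorem]
  · change (Unitary.conjStarAlgAut ℝ _ U C).rank ≤ _
    rw [Unitary.conjStarAlgAut_apply]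
    exact (rank_mul_le_left _ _).trans (rank_mul_le_right _ _)

/-- An algebraic relation and a rank bound transfer between real symmetric matrices with the
same characteristic polynomial. -/
lemma Matrix.IsHermitian.quartic_and_rank_of_charpoly_eq {V W : Type*} [Fintype V] [Fintype W]
    [DecidableEq V] [DecidableEq W] {A : Matrix V V ℝ} {B : Matrix W W ℝ}
    (hA : A.IsHermitian) (hB : B.IsHermitian) (h : A.charpoly = B.charpoly) (t : ℝ) (k : ℕ)
    (hq : (B * B - 1) * (B * B - B - t • 1) = 0) (hr : (B * B - 1).rank ≤ k) :
    (A * A - 1) * (A * A - A - t • 1) = 0 ∧ (A * A - 1).rank ≤ k := by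
  have hcard : Fintype.card W = Fintype.card V := by
    rw [← B.charpoly_natDegree_eq_dim, ← h, A.charpoly_natDegree_eq_dim]
  let ψ := Matrix.reindexAlgEquiv ℝ ℝ (Fintype.equivOfCardEq hcard)
  have hB' : (ψ B).IsHermitian := hB.submatrix _
  obtain ⟨φ, rfl, hφr⟩ := hA.exists_conj_of_charpoly_eq hB' (by
    rw [h]; exact (Matrix.charpoly_reindex _ _).symm)
  constructor
  · have := congrArg (fun C => φ (ψ C)) hq
    simpa using this
  · have : φ (ψ B) * φ (ψ B) - 1 = φ (ψ (B * B - 1)) := by simp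
    rw [this]
    refine (hφr _).trans (le_of_eq_of_le ?_ hr)
    exact Matrix.rank_reindex _ _ _

open Matrix in
lemma Matrix.rank_vecMulVec_add_vecMulVec_le {V W : Type*} [Fintype W]
    (a c : V → ℝ) (b d : W → ℝ) : (vecMulVec a b + vecMulVec c d).rank ≤ 2 := by
  have h : vecMulVec a b + vecMulVec c d = (of ![a, c])ᵀ * of ![b, d] := by
    ext i j
    simp [vecMulVec_apply, mul_apply, Fin.sum_univ_two]
  rw [h]
  exact (rank_mul_le_right _ _).trans (by simpa using rank_le_card_height (of ![b, d]))

lemma adjMat_eq_adjMatrix (R : Type*) [Zero R] [One R] {V : Type*} [Fintype V]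
    (G : SimpleGraph V) [DecidableRel G.Adj] : adjMat R G = G.adjMatrix R := by
  unfold adjMat
  congr!

lemma adjMat_isHermitian {V : Type*} [Fintype V] (G : SimpleGraph V) :
    (adjMat ℝ G).IsHermitian := by
  classical
  rw [adjMat_eq_adjMatrix]
  ext i j
  simp [SimpleGraph.adjMatrix_apply, G.adj_comm]

namespace friendshipGraph

lemma adj_none_some {n : ℕ} (p : Fin n × Bool) : (friendshipGraph n).Adj none (some p) := by
  simp [friendshipGraph]

lemma adj_some_some {n : ℕ} (p q : Fin n × Bool) :
    (friendshipGraph n).Adj (some p) (some q) ↔ q = (p.1, !p.2) := by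
  obtain ⟨i, b⟩ := p
  obtain ⟨j, b'⟩ := q
  cases b <;> cases b' <;> simp [friendshipGraph]; grind

lemma adjMat_none_none {n : ℕ} : adjMat ℝ (friendshipGraph n) none none = 0 := by
  classical
  simp [adjMat_eq_adjMatrix]

lemma adjMat_none_some {n : ℕ} (p : Fin n × Bool) :
    adjMat ℝ (friendshipGraph n) none (some p) = 1 := by
  classical
  simp [adjMat_eq_adjMatrix, adj_none_some]

lemma adjMat_some_none {n : ℕ} (p : Fin n × Bool) :
    adjMat ℝ (friendshipGraph n) (some p) none = 1 := by
  classical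
  simp [adjMat_eq_adjMatrix, (adj_none_some p).symm]

lemma adjMat_some_some {n : ℕ} (p q : Fin n × Bool) :
    adjMat ℝ (friendshipGraph n) (some p) (some q) = if q = (p.1, !p.2) then 1 else 0 := by
  classical
  simp [adjMat_eq_adjMatrix, SimpleGraph.adjMatrix_apply, adj_some_some]

lemma eq_flip_iff {n : ℕ} (p q : Fin n × Bool) : q = (p.1, !p.2) ↔ p = (q.1, !q.2) := by
  obtain ⟨i, b⟩ := p
  obtain ⟨j, b'⟩ := q
  cases b <;> cases b' <;> simp [eq_comm]

lemma adjMat_mul_self_sub_one (n : ℕ) :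
    adjMat ℝ (friendshipGraph n) * adjMat ℝ (friendshipGraph n) - 1 =
      Matrix.vecMulVec 1 1 +
        Matrix.vecMulVec (Pi.single none (2 * (n : ℝ) - 2)) (Pi.single none 1) := by
  ext (_ | p) (_ | q)
  · simp [Matrix.mul_apply, Fintype.sum_option, adjMat_none_none, adjMat_none_some,
      adjMat_some_none, Matrix.vecMulVec_apply]
    ring
  · simp [Matrix.mul_apply, Fintype.sum_option, adjMat_none_none, adjMat_none_some,
      adjMat_some_some, eq_flip_iff _ q, Matrix.vecMulVec_apply]
  · simp [Matrix.mul_apply, Fintype.sum_option, adjMat_none_none, adjMat_some_none,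
      adjMat_some_some, Matrix.vecMulVec_apply]
  · simp [Matrix.mul_apply, Fintype.sum_option, adjMat_none_some, adjMat_some_none,
      adjMat_some_some, eq_flip_iff _ q, Matrix.vecMulVec_apply, Matrix.one_apply]
    simp [Prod.ext_iff, eq_comm]

lemma rank_adjMat_mul_self_sub_one_le (n : ℕ) :
    (adjMat ℝ (friendshipGraph n) * adjMat ℝ (friendshipGraph n) - 1).rank ≤ 2 := by
  rw [adjMat_mul_self_sub_one]
  exact Matrix.rank_vecMulVec_add_vecMulVec_le _ _ _ _

lemma adjMat_quartic (n : ℕ) :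
    (adjMat ℝ (friendshipGraph n) * adjMat ℝ (friendshipGraph n) - 1) *
      (adjMat ℝ (friendshipGraph n) * adjMat ℝ (friendshipGraph n) -
        adjMat ℝ (friendshipGraph n) - (2 * n : ℝ) • 1) = 0 := by
  rw [← sub_add_cancel (adjMat ℝ (friendshipGraph n) * adjMat ℝ (friendshipGraph n)) 1,
    adjMat_mul_self_sub_one, add_sub_cancel_right]
  ext (_ | p) (_ | q)
  · simp [Matrix.mul_apply, Fintype.sum_option, adjMat_none_none, adjMat_some_none,
      Matrix.vecMulVec_apply, Matrix.one_apply]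
    exact Or.inr (by ring)
  · simp [Matrix.mul_apply, Fintype.sum_option,
      adjMat_none_some, adjMat_some_some, eq_flip_iff _ q, Matrix.vecMulVec_apply,
      Matrix.one_apply, Finset.sum_add_distrib, Finset.sum_sub_distrib]
    ring
  · simp [Matrix.mul_apply, Fintype.sum_option, adjMat_none_none, adjMat_some_none,
      Matrix.vecMulVec_apply,
      Matrix.one_apply, Finset.sum_add_distrib, Finset.sum_sub_distrib]
    ring
  · simp [Matrix.mul_apply, Fintype.sum_option,
      adjMat_none_some, adjMat_some_some, eq_flip_iff _ q, Matrix.vecMulVec_apply,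
      Matrix.one_apply, Finset.sum_add_distrib, Finset.sum_sub_distrib]
    ring

end friendshipGraph

/-- A graph with a vertex `c` adjacent to all others, all others having degree two, is a
friendship graph. -/
lemma nonempty_iso_friendshipGraph {V : Type*} [Fintype V] [DecidableEq V] {n : ℕ}
    (G : SimpleGraph V) [DecidableRel G.Adj] (c : V) (hc : ∀ x, x ≠ c → G.Adj c x)
    (hdc : G.degree c = 2 * n) (hd : ∀ x, x ≠ c → G.degree x = 2) :
    Nonempty (G ≃g friendshipGraph n) := by
  have hex : ∀ x, ∃ y, x ≠ c → y ≠ c ∧ ∀ z, G.Adj x z ↔ z = c ∨ z = y := by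
    intro x
    by_cases hx : x = c
    · exact ⟨x, fun h => absurd hx h⟩
    obtain ⟨y, hy⟩ := Finset.card_eq_one.1 (show ((G.neighborFinset x).erase c).card = 1 by
      rw [Finset.card_erase_of_mem (by simpa using (hc x hx).symm), G.card_neighborFinset_eq_degree,
        hd x hx])
    have hz : ∀ z, z ≠ c ∧ G.Adj x z ↔ z = y := fun z => by simpa using Finset.ext_iff.1 hy z
    refine ⟨y, fun _ => ⟨((hz y).2 rfl).1, fun z => ?_⟩⟩
    have := (hc x hx).symm
    grind
  choose σ hσ using hex
  have hσσ : ∀ x, x ≠ c → σ (σ x) = x := by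
    intro x hx
    have h1 := ((hσ x hx).2 (σ x)).2 (Or.inr rfl)
    have h2 := ((hσ _ (hσ x hx).1).2 x).1 h1.symm
    grind
  have hσne : ∀ x, x ≠ c → σ x ≠ x := by
    intro x hx h
    have h1 := ((hσ x hx).2 (σ x)).2 (Or.inr rfl)
    rw [h] at h1
    exact G.irrefl h1
  let ord := Fintype.equivFin V
  let S := {x : V // x ≠ c ∧ ord x < ord (σ x)}
  let f : Option (S × Bool) → V := fun p => p.elim c fun p => if p.2 then p.1.1 else σ p.1.1
  have hf : Function.Bijective f := by
    constructor
    · rintro (_ | ⟨⟨s, hs, hs'⟩, b⟩) (_ | ⟨⟨t, ht, ht'⟩, b'⟩) h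
      · rfl
      · have := (hσ t ht).1
        cases b' <;> simp [f] at h <;> grind
      · have := (hσ s hs).1
        cases b <;> simp [f] at h <;> grind
      · have h1 := hσσ s hs
        have h2 := hσσ t ht
        cases b <;> cases b' <;> simp [f] at h ⊢ <;> grind
    · intro x
      by_cases hx : x = c
      · exact ⟨none, hx.symm⟩
      rcases lt_trichotomy (ord x) (ord (σ x)) with h | h | h
      · exact ⟨some (⟨x, hx, h⟩, true), rfl⟩
      · exact absurd (ord.injective h).symm (hσne x hx)
      · exact ⟨some (⟨σ x, (hσ x hx).1, by rwa [hσσ x hx]⟩, false), hσσ x hx⟩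
  have hV : Fintype.card V = 2 * n + 1 := by
    have h : G.neighborFinset c = Finset.univ.erase c := by
      ext x
      simp only [SimpleGraph.mem_neighborFinset, Finset.mem_erase, Finset.mem_univ, and_true]
      exact ⟨fun h => h.ne', hc x⟩
    rw [← hdc, ← G.card_neighborFinset_eq_degree, h, Finset.card_erase_add_one (Finset.mem_univ c),
      Finset.card_univ]
  have hS : Fintype.card S = n := by
    have := Fintype.card_of_bijective hf
    simp only [Fintype.card_option, Fintype.card_prod, Fintype.card_bool] at this
    omega
  let g : Option (Fin n × Bool) ≃ V :=
    (Equiv.optionCongr ((Fintype.equivFinOfCardEq hS).symm.prodCongr (Equiv.refl Bool))).trans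
      (Equiv.ofBijective f hf)
  have hg0 : g none = c := rfl
  have hgne : ∀ p, g (some p) ≠ c := fun p h => by simpa using g.injective (h.trans hg0.symm)
  have hgσ : ∀ i b, g (some (i, !b)) = σ (g (some (i, b))) := by
    intro i b
    cases b
    · exact (hσσ _ ((Fintype.equivFinOfCardEq hS).symm i).2.1).symm
    · rfl
  refine ⟨RelIso.symm ⟨g, ?_⟩⟩
  rintro (_ | p) (_ | q)
  · simp
  · exact iff_of_true (hc _ (hgne q)) (friendshipGraph.adj_none_some q)
  · exact iff_of_true (hc _ (hgne p)).symm (friendshipGraph.adj_none_some p).symm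
  · rw [friendshipGraph.adj_some_some, (hσ _ (hgne p)).2, ← hgσ]
    simp [hgne]

open Matrix in
/-- A matrix of rank at most two which has an identity principal `2 × 2` block is determined by
the corresponding rows and columns. -/
lemma Matrix.apply_eq_of_rank_le_two {V : Type*} [Fintype V] {M : Matrix V V ℝ}
    (hr : M.rank ≤ 2) {u v : V} (huu : M u u = 1) (hvv : M v v = 1) (huv : M u v = 0)
    (hvu : M v u = 0) (x y : V) : M x y = M x u * M u y + M x v * M v y := by
  have h : (M.submatrix ![u, v, x] ![u, v, y]).det = 0 := by
    by_contra h
    have h1 := rank_of_det_ne_zero h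
    have h2 := M.rank_submatrix_le ![u, v, x] ![u, v, y]
    simp only [Fintype.card_fin] at h1
    omega
  rw [Matrix.det_fin_three] at h
  simp [huu, hvv, huv, hvu] at h
  linarith

lemma SimpleGraph.adjMatrix_comm {V : Type*} (G : SimpleGraph V) [DecidableRel G.Adj]
    (x y : V) : G.adjMatrix ℝ x y = G.adjMatrix ℝ y x := by
  simp [G.adj_comm]

section DegreeTwo

variable {V : Type*} [Fintype V] [DecidableEq V] {G : SimpleGraph V} [DecidableRel G.Adj]

lemma SimpleGraph.exists_neighborFinset_eq_pair {u v : V} (h : G.Adj u v) (hd : G.degree u = 2) :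
    ∃ a, a ≠ v ∧ G.neighborFinset u = {v, a} := by
  obtain ⟨a, ha⟩ := Finset.card_eq_one.1 (show ((G.neighborFinset u).erase v).card = 1 by
    rw [Finset.card_erase_of_mem (by simpa using h), G.card_neighborFinset_eq_degree, hd])
  have hv : v ∈ G.neighborFinset u := by simpa using h
  refine ⟨a, ?_, ?_⟩
  · rintro rfl
    have : a ∈ (G.neighborFinset u).erase a := by simp [ha]
    simp at this
  · rw [← Finset.insert_erase hv, ha]

lemma SimpleGraph.adjMatrix_mul_apply_of_neighborFinset_eq_pair {u v a : V}
    (hva : a ≠ v) (h : G.neighborFinset u = {v, a}) (M : Matrix V V ℝ) (y : V) :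
    (G.adjMatrix ℝ * M) u y = M v y + M a y := by
  rw [G.adjMatrix_mul_apply, h, Finset.sum_pair hva.symm]

lemma SimpleGraph.adjMatrix_apply_of_neighborFinset_eq_pair {u v a : V}
    (h : G.neighborFinset u = {v, a}) (y : V) :
    G.adjMatrix ℝ u y = if y = v ∨ y = a then 1 else 0 := by
  have : G.Adj u y ↔ y = v ∨ y = a := by
    rw [← G.mem_neighborFinset, h]; simp
  simp [this]

lemma Matrix.mul_quartic {A : Matrix V V ℝ} {t : ℝ}
    (hq : (A * A - 1) * (A * A - A - t • 1) = 0) :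
    (A * A - 1) * (A * A) = A * (A * A - 1) + t • (A * A - 1) := by
  have h : A * (A * A - 1) = (A * A - 1) * A := by noncomm_ring
  rw [h]
  rw [mul_sub, mul_sub, sub_sub, sub_eq_zero] at hq
  rw [hq, Matrix.mul_smul, mul_one]

/-- Under the spectral hypotheses, two adjacent vertices `u`, `v` of degree two lie in a triangle. -/
lemma common_neighbor_of_quartic {t : ℝ}
    (hq : (G.adjMatrix ℝ * G.adjMatrix ℝ - 1) *
      (G.adjMatrix ℝ * G.adjMatrix ℝ - G.adjMatrix ℝ - t • 1) = 0)
    (hr : (G.adjMatrix ℝ * G.adjMatrix ℝ - 1).rank ≤ 2) {u v a b : V}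
    (hav : a ≠ v) (hu : G.neighborFinset u = {v, a})
    (hbu : b ≠ u) (hv : G.neighborFinset v = {u, b}) : a = b := by
  by_contra hab
  have huv : u ≠ v := by
    have : G.Adj u v := by rw [← G.mem_neighborFinset, hu]; simp
    exact this.ne
  have hua : u ≠ a := by
    have : G.Adj u a := by rw [← G.mem_neighborFinset, hu]; simp
    exact this.ne
  have hvb : v ≠ b := by
    have : G.Adj v b := by rw [← G.mem_neighborFinset, hv]; simp
    exact this.ne
  have hq' := Matrix.mul_quartic hq
  set A := G.adjMatrix ℝ with hA
  set M := A * A - 1 with hM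
  have hAu : ∀ y, A u y = if y = v ∨ y = a then 1 else 0 :=
    SimpleGraph.adjMatrix_apply_of_neighborFinset_eq_pair hu
  have hAv : ∀ y, A v y = if y = u ∨ y = b then 1 else 0 :=
    SimpleGraph.adjMatrix_apply_of_neighborFinset_eq_pair hv
  have hAMu : ∀ (N : Matrix V V ℝ) y, (A * N) u y = N v y + N a y :=
    SimpleGraph.adjMatrix_mul_apply_of_neighborFinset_eq_pair hav hu
  have hAMv : ∀ (N : Matrix V V ℝ) y, (A * N) v y = N u y + N b y :=
    SimpleGraph.adjMatrix_mul_apply_of_neighborFinset_eq_pair hbu hv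
  have hsymm : ∀ x y, A x y = A y x := G.adjMatrix_comm
  have hMsymm : ∀ x y, M x y = M y x := fun x y => by
    simp only [hM, Matrix.sub_apply, Matrix.mul_apply, Matrix.one_apply, hsymm x, hsymm _ y,
      eq_comm (a := x), mul_comm]
  have hMu : ∀ y, M u y = A v y + A a y - (1 : Matrix V V ℝ) u y := fun y => by
    rw [hM, Matrix.sub_apply, hAMu]
  have hMv : ∀ y, M v y = A u y + A b y - (1 : Matrix V V ℝ) v y := fun y => by
    rw [hM, Matrix.sub_apply, hAMv]
  have hdiag : ∀ x, A x x = 0 := fun x => by simp [hA]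
  have huu : M u u = 1 := by simp [hMu, hAv, hsymm a u, hAu]
  have hvv : M v v = 1 := by simp [hMv, hAu, hsymm b v, hAv]
  have huv0 : M u v = 0 := by simp [hMu, hdiag, hsymm a v, hAv, huv, hua.symm, hab]
  have hMua : M u a = 0 := by simp [hMu, hAv, hdiag, hua, hua.symm, hab]
  have hMvb : M v b = 0 := by simp [hMv, hAu, hdiag, hvb, hvb.symm, Ne.symm hab]
  have hMva : M v a = 1 + A a b := by simp [hMv, hAu, hsymm b a, hav.symm]
  have hMub : M u b = 1 + A a b := by simp [hMu, hAv, hbu.symm]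
  have hrank := Matrix.apply_eq_of_rank_le_two hr huu hvv huv0 ((hMsymm _ _).trans huv0)
  have hMa : ∀ y, M a y = (1 + A a b) * M v y := fun y => by
    rw [hrank a y, hMsymm a u, hMua, hMsymm a v, hMva]; ring
  have hMb : ∀ y, M b y = (1 + A a b) * M u y := fun y => by
    rw [hrank b y, hMsymm b u, hMub, hMsymm b v, hMvb]; ring
  have hAM : A * M = M * A := by rw [hM]; noncomm_ring
  have hrow : ∀ y, (M * A) u y = (2 + A a b) * M v y := fun y => by
    rw [← hAM, hAMu, hMa]; ring
  have hrow' : ∀ y, (M * A) v y = (2 + A a b) * M u y := fun y => by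
    rw [← hAM, hAMv, hMb]; ring
  have key := congrFun (congrFun hq' u) v
  rw [hAM, ← mul_assoc, Matrix.add_apply, Matrix.smul_apply, huv0, hrow, hvv,
    Matrix.mul_apply] at key
  simp only [hrow, mul_assoc, ← Finset.mul_sum] at key
  rw [← Matrix.mul_apply, hrow', huv0] at key
  have : 0 ≤ A a b := by
    rw [hA, G.adjMatrix_apply]; split_ifs <;> norm_num
  simp at key
  linarith

/-- If the triangle `u`, `v`, `c` has `u` and `v` of degree two, then `c` is adjacent to all other
vertices, which all have degree two. -/
lemma degree_eq_of_quartic {n : ℕ}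
    (hq : (G.adjMatrix ℝ * G.adjMatrix ℝ - 1) *
      (G.adjMatrix ℝ * G.adjMatrix ℝ - G.adjMatrix ℝ - (2 * n : ℝ) • 1) = 0) {u v c : V}
    (hcv : c ≠ v) (hu : G.neighborFinset u = {v, c})
    (hcu : c ≠ u) (hv : G.neighborFinset v = {u, c})
    (hcard : Fintype.card V = 2 * n + 1) :
    G.degree c = 2 * n ∧ (∀ x, x ≠ c → G.Adj c x) ∧ ∀ x, x ≠ c → G.degree x = 2 := by
  have huv : u ≠ v := by
    have : G.Adj u v := by rw [← G.mem_neighborFinset, hu]; simp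
    exact this.ne
  have hq' := Matrix.mul_quartic hq
  have hrowsum : ∀ x, ∑ y, G.adjMatrix ℝ y x = G.degree x := fun x => by
    simp [Finset.sum_boole, ← G.card_neighborFinset_eq_degree,
      G.neighborFinset_eq_filter, G.adj_comm _ x]
  set A := G.adjMatrix ℝ with hA
  set M := A * A - 1 with hM
  have hAu : ∀ y, A u y = if y = v ∨ y = c then 1 else 0 :=
    SimpleGraph.adjMatrix_apply_of_neighborFinset_eq_pair hu
  have hAv : ∀ y, A v y = if y = u ∨ y = c then 1 else 0 :=
    SimpleGraph.adjMatrix_apply_of_neighborFinset_eq_pair hv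
  have hAMu : ∀ (N : Matrix V V ℝ) y, (A * N) u y = N v y + N c y :=
    SimpleGraph.adjMatrix_mul_apply_of_neighborFinset_eq_pair hcv hu
  have hAMv : ∀ (N : Matrix V V ℝ) y, (A * N) v y = N u y + N c y :=
    SimpleGraph.adjMatrix_mul_apply_of_neighborFinset_eq_pair hcu hv
  have hsymm : ∀ x y, A x y = A y x := G.adjMatrix_comm
  have hMsymm : ∀ x y, M x y = M y x := fun x y => by
    simp only [hM, Matrix.sub_apply, Matrix.mul_apply, Matrix.one_apply, hsymm x, hsymm _ y,
      eq_comm (a := x), mul_comm]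
  have hMu : ∀ y, M u y = A c y + if y = c then 1 else 0 := fun y => by
    rw [hM, Matrix.sub_apply, hAMu, hAv, Matrix.one_apply]
    grind
  have hMv : ∀ y, M v y = A c y + if y = c then 1 else 0 := fun y => by
    rw [hM, Matrix.sub_apply, hAMv, hAu, Matrix.one_apply]
    grind
  have hdiag : A c c = 0 := by simp [hA]
  have hcu1 : A c u = 1 := by rw [hsymm, hAu]; simp
  have hAM : A * M = M * A := by rw [hM]; noncomm_ring
  have hdegR : (G.degree c : ℝ) = 2 * n := by
    have key := congrFun (congrFun hq' u) u
    rw [show A * A = M + 1 by rw [hM, sub_add_cancel], mul_add, mul_one, Matrix.add_apply,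
      Matrix.add_apply, hAMu, Matrix.smul_apply, hMsymm c u, Matrix.mul_apply] at key
    have hsq : ∀ y, M u y * M y u = A y c + if y = c then 1 else 0 := fun y => by
      rw [hMsymm y u, hMu, hsymm y c]
      by_cases hy : y = c
      · simp [hy, hdiag]
      · simp [hy, hA]
    rw [Finset.sum_congr rfl fun y _ => hsq y, Finset.sum_add_distrib, hrowsum, hMu, hMu, hMv,
      hcu1, if_neg hcu.symm] at key
    simp at key
    linarith
  have hdeg : G.degree c = 2 * n := by exact_mod_cast hdegR
  have hadj : ∀ x, x ≠ c → G.Adj c x := by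
    intro x hx
    have hsub : G.neighborFinset c ⊆ Finset.univ.erase c := fun z hz => by
      simpa using ((G.mem_neighborFinset c z).1 hz).ne'
    have := Finset.eq_of_subset_of_card_le hsub (by
      rw [Finset.card_erase_of_mem (Finset.mem_univ c), Finset.card_univ,
        G.card_neighborFinset_eq_degree]; omega)
    rw [← G.mem_neighborFinset, this]
    simpa using hx
  refine ⟨hdeg, hadj, ?_⟩
  have hMone : ∀ y, M u y = 1 := fun y => by
    rw [hMu]
    by_cases hy : y = c
    · simp [hy, hdiag]
    · simp [hy, hA, hadj y hy]
  have hsum : ∀ x, ∑ z ∈ G.neighborFinset x, G.degree z = G.degree x + 2 * n := by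
    intro x
    have key := congrFun (congrFun hq' u) x
    rw [hAM, ← mul_assoc, Matrix.add_apply, Matrix.smul_apply, hMone, hA,
      G.mul_adjMatrix_apply, G.mul_adjMatrix_apply] at key
    simp only [← hA, Matrix.mul_apply, hMone, one_mul, hrowsum] at key
    simp at key
    exact_mod_cast key
  intro x hx
  have h1 := hsum x
  have hcx : c ∈ G.neighborFinset x := by simpa using (hadj x hx).symm
  rw [← Finset.add_sum_erase _ _ hcx, hdeg, add_comm, add_left_inj] at h1
  have hc1 : ((G.neighborFinset x).erase c).card + 1 = G.degree x := by
    rw [Finset.card_erase_add_one hcx, G.card_neighborFinset_eq_degree]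
  have h2 : ∀ y, y ≠ c → 2 ≤ G.degree y := by
    intro y hy
    have h1 := hsum y
    have hcy : c ∈ G.neighborFinset y := by simpa using (hadj y hy).symm
    rw [← Finset.add_sum_erase _ _ hcy, hdeg, add_comm, add_left_inj] at h1
    have hc1 := Finset.card_erase_add_one hcy
    rw [G.card_neighborFinset_eq_degree] at hc1
    by_contra hlt
    have : (G.neighborFinset y).erase c = ∅ := Finset.card_eq_zero.1 (by omega)
    simp [this] at h1
    omega
  have h3 : ((G.neighborFinset x).erase c).card • 2 ≤
      ∑ z ∈ (G.neighborFinset x).erase c, G.degree z :=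
    Finset.card_nsmul_le_sum _ _ _ fun z hz => h2 z (Finset.ne_of_mem_erase hz)
  have h4 := h2 x hx
  rw [h1, smul_eq_mul] at h3
  omega

end DegreeTwo

/-- if `G` is cospectral with the friendship graph `F n` and contains two
adjacent vertices that both have degree 2, then `G ≅ F n`. -/
theorem cospectral_adjacent_degree_two_iso
    {V : Type*} [Fintype V] [DecidableEq V]
    (n : ℕ) (hn : 0 < n) (G : SimpleGraph V) [DecidableRel G.Adj]
    (hG : Cospectral G (friendshipGraph n))
    (x y : V) (hxy : G.Adj x y) (hdx : G.degree x = 2) (hdy : G.degree y = 2) :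
    Nonempty (G ≃g friendshipGraph n) := by
  obtain ⟨a, hay, hx⟩ := SimpleGraph.exists_neighborFinset_eq_pair hxy hdx
  obtain ⟨b, hbx, hy⟩ := SimpleGraph.exists_neighborFinset_eq_pair hxy.symm hdy
  have hcard : Fintype.card V = 2 * n + 1 := by
    rw [← (adjMat ℝ G).charpoly_natDegree_eq_dim, hG, Matrix.charpoly_natDegree_eq_dim]
    simp [mul_comm]
  obtain ⟨hq, hr⟩ := (adjMat_isHermitian G).quartic_and_rank_of_charpoly_eq
    (adjMat_isHermitian _) hG (2 * n) 2 (friendshipGraph.adjMat_quartic n)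
    (friendshipGraph.rank_adjMat_mul_self_sub_one_le n)
  rw [adjMat_eq_adjMatrix] at hq hr
  obtain rfl := common_neighbor_of_quartic hq hr hay hx hbx hy
  obtain ⟨hdeg, hadj, hdeg2⟩ := degree_eq_of_quartic hq hay hx hbx hy hcard
  exact nonempty_iso_friendshipGraph G a hadj hdeg hdeg2
end
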